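/- If the Lr (a,τ) interval exchange transformation T is irreducible and satisfies the Keane Condition, then T and T̃ are minimal: for every x ∈ [0,1) the orbit {T^k x : k ∈ ℤ} is dense in [0,1), and for every x ∈ (0,1] the orbit {T̃^k x : k ∈ ℤ} is dense in (0,1]. -/

import Mathlib

open Set

noncomputable section

/-- `bpt a k = a_1 + ⋯ + a_k` (0-indexed: the sum of the first `k` entries of `a`);
these are the division points `b_k` of the interval exchange. -/
def bpt {n : ℕ} (a : Fin n → ℝ) (k : ℕ) : ℝ :=
  ∑ j ∈ Finset.univ.filter (fun j : Fin n => (j : ℕ) < k), a j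

/-- The left-closed right-open interval `J_i = [b_{i-1}, b_i)` (0-indexed). -/
def Jint {n : ℕ} (a : Fin n → ℝ) (i : Fin n) : Set ℝ :=
  Set.Ico (bpt a (i : ℕ)) (bpt a ((i : ℕ) + 1))

/-- The left-open right-closed interval `J̃_i = (b_{i-1}, b_i]` (0-indexed). -/
def Jtil {n : ℕ} (a : Fin n → ℝ) (i : Fin n) : Set ℝ :=
  Set.Ioc (bpt a (i : ℕ)) (bpt a ((i : ℕ) + 1))

/-- The permuted probability vector `a^τ`, with `a^τ_{τ(i)} = a_i`. -/
def aperm {n : ℕ} (a : Fin n → ℝ) (τ : Equiv.Perm (Fin n)) : Fin n → ℝ :=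
  fun j => a (τ.symm j)

/-- The set `D = {b_1, …, b_{n-1}}` of interior division points. -/
def Dset {n : ℕ} (a : Fin n → ℝ) : Set ℝ :=
  {x | ∃ k : ℕ, 0 < k ∧ k < n ∧ x = bpt a k}

/-- `a` is a positive probability vector. -/
def IsProbVec {n : ℕ} (a : Fin n → ℝ) : Prop :=
  (∀ i, 0 < a i) ∧ ∑ i, a i = 1

/-- `T` is the Lr `(a,τ)` interval exchange transformation: on each
`J_i = [b_{i-1}, b_i)` it is the translation `x ↦ x - b_{i-1} + b^τ_{τ(i)-1}`. -/
def IsLrIET {n : ℕ} (a : Fin n → ℝ) (τ : Equiv.Perm (Fin n)) (T : ℝ → ℝ) : Prop :=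
  ∀ i : Fin n, ∀ x ∈ Jint a i, T x = x - bpt a (i : ℕ) + bpt (aperm a τ) ((τ i : ℕ))

/-- `Tt` is the dual lR `(a,τ)` interval exchange transformation: on each
`J̃_i = (b_{i-1}, b_i]` it is the translation `x ↦ x - b_{i-1} + b^τ_{τ(i)-1}`. -/
def IslRIET {n : ℕ} (a : Fin n → ℝ) (τ : Equiv.Perm (Fin n)) (Tt : ℝ → ℝ) : Prop :=
  ∀ i : Fin n, ∀ x ∈ Jtil a i, Tt x = x - bpt a (i : ℕ) + bpt (aperm a τ) ((τ i : ℕ))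

/-- The Keane Condition: `D ∩ T^k(D) = ∅` for every positive integer `k`. -/
def KeaneCond {n : ℕ} (a : Fin n → ℝ) (T : ℝ → ℝ) : Prop :=
  ∀ k : ℕ, 0 < k → Dset a ∩ (T^[k] '' Dset a) = ∅

/-- `τ` is irreducible: `τ({1,…,j}) ≠ {1,…,j}` for `j = 1, …, n-1` (0-indexed:
no proper initial segment is invariant). -/
def IrreduciblePerm {n : ℕ} (τ : Equiv.Perm (Fin n)) : Prop :=
  ∀ j : ℕ, 0 < j → j < n →
    (fun i => τ i) '' {i : Fin n | (i : ℕ) < j} ≠ {i : Fin n | (i : ℕ) < j}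

/-- `P` is the family of ℤ-iterates of `T` on `[0,1)`: `P 0 = id`,
`P (k+1) = T ∘ P k`, and each `P k` maps `[0,1)` into itself. -/
def IsZIterLr (T : ℝ → ℝ) (P : ℤ → ℝ → ℝ) : Prop :=
  (∀ x ∈ Set.Ico (0 : ℝ) 1, P 0 x = x) ∧
  ∀ k : ℤ, ∀ x ∈ Set.Ico (0 : ℝ) 1, P k x ∈ Set.Ico (0 : ℝ) 1 ∧ P (k + 1) x = T (P k x)

/-- `Pt` is the family of ℤ-iterates of `Tt` on `(0,1]`. -/
def IsZIterlR (Tt : ℝ → ℝ) (Pt : ℤ → ℝ → ℝ) : Prop :=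
  (∀ x ∈ Set.Ioc (0 : ℝ) 1, Pt 0 x = x) ∧
  ∀ k : ℤ, ∀ x ∈ Set.Ioc (0 : ℝ) 1, Pt k x ∈ Set.Ioc (0 : ℝ) 1 ∧ Pt (k + 1) x = Tt (Pt k x)

/-- `I` is the itinerary map of `T` (with ℤ-iterates `P`):
`𝓘(x)_k = i ↔ T^k x ∈ J_i` for `x ∈ [0,1)`. -/
def IsItin {n : ℕ} (a : Fin n → ℝ) (P : ℤ → ℝ → ℝ) (I : ℝ → ℤ → Fin n) : Prop :=
  ∀ x ∈ Set.Ico (0 : ℝ) 1, ∀ k : ℤ, ∀ i : Fin n, (I x k = i ↔ P k x ∈ Jint a i)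

/-- `It` is the itinerary map of `Tt` (with ℤ-iterates `Pt`):
`𝓘̃(x)_k = i ↔ T̃^k x ∈ J̃_i` for `x ∈ (0,1]`. -/
def IsItinDual {n : ℕ} (a : Fin n → ℝ) (Pt : ℤ → ℝ → ℝ) (It : ℝ → ℤ → Fin n) : Prop :=
  ∀ x ∈ Set.Ioc (0 : ℝ) 1, ∀ k : ℤ, ∀ i : Fin n, (It x k = i ↔ Pt k x ∈ Jtil a i)

/-- `D_∞ = {0,1} ∪ ⋃_{k ∈ ℤ} T^k(D)`. -/
def Dinf {n : ℕ} (a : Fin n → ℝ) (P : ℤ → ℝ → ℝ) : Set ℝ :=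
  {0, 1} ∪ ⋃ k : ℤ, P k '' Dset a

/-- The set `R = [0,1] ∖ D_∞` of regular points. -/
def Rset {n : ℕ} (a : Fin n → ℝ) (P : ℤ → ℝ → ℝ) : Set ℝ :=
  Set.Icc 0 1 \ Dinf a P

/-- The shift `S` on `Ω = {1,…,n}^ℤ`: `S(α)_i = α_{i+1}`. -/
def shiftS {n : ℕ} (α : ℤ → Fin n) : ℤ → Fin n := fun i => α (i + 1)

/-- The `k`-th power of the shift: `(S^k α)_i = α_{i+k}`. -/
def shiftZ {n : ℕ} (k : ℤ) (α : ℤ → Fin n) : ℤ → Fin n := fun i => α (i + k)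

/-- `α, β` are positively asymptotic: `α_i = β_i` for all `i ≥ N`, some `N`. -/
def PosAsymp {n : ℕ} (α β : ℤ → Fin n) : Prop :=
  ∃ N : ℕ, ∀ i : ℤ, (N : ℤ) ≤ i → α i = β i

/-- `α, β` are negatively asymptotic: `α_i = β_i` for all `i ≤ -N`, some `N`. -/
def NegAsymp {n : ℕ} (α β : ℤ → Fin n) : Prop :=
  ∃ N : ℕ, ∀ i : ℤ, i ≤ -(N : ℤ) → α i = β i

/-- `T` is an injective self-map of `[0,1)` which acts as a translation on every interval `[y, z]`
such that `(y, z]` contains no point of the finite set `D`. -/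
structure IsPiecewiseTranslation (T : ℝ → ℝ) (D : Set ℝ) : Prop where
  mapsTo : MapsTo T (Ico 0 1) (Ico 0 1)
  injOn : InjOn T (Ico 0 1)
  finite : D.Finite
  translation : ∀ y ∈ Ico (0 : ℝ) 1, ∀ z ∈ Ico (0 : ℝ) 1, y ≤ z → (∀ x ∈ Ioc y z, x ∉ D) →
    T z = T y + (z - y)

/-- Among infinitely many terms of a sequence in `[0,1)`, two are closer than `ε`. -/
lemma exists_lt_abs_sub_lt {u : ℕ → ℝ} (hu : ∀ k, u k ∈ Ico (0 : ℝ) 1) {ε : ℝ} (hε : 0 < ε) :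
    ∃ k l, k < l ∧ |u k - u l| < ε := by
  obtain ⟨k, l, hkl, h⟩ := Set.Finite.exists_lt_map_eq_of_forall_mem
    (f := fun k => ⌊u k / ε⌋₊) (t := Iic ⌊1 / ε⌋₊) (fun k => Nat.floor_le_floor (by
      gcongr; exact (hu k).2.le)) (Set.finite_Iic _)
  refine ⟨k, l, hkl, ?_⟩
  have h1 := Nat.floor_le (div_nonneg (hu k).1 hε.le)
  have h2 := Nat.floor_le (div_nonneg (hu l).1 hε.le)
  have h3 := Nat.lt_floor_add_one (u k / ε)
  have h4 := Nat.lt_floor_add_one (u l / ε)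
  rw [h] at h1 h3
  have h5 : |u k / ε - u l / ε| < 1 := by rw [abs_lt]; constructor <;> linarith
  rwa [← sub_div, abs_div, abs_of_pos hε, div_lt_one hε] at h5

/-- A finite set containing `c` and `d` cuts `[c, d)` into pieces of length bounded below. -/
lemma Set.Finite.exists_cut_length {C : Set ℝ} (hC : C.Finite) {c d : ℝ} (hc : c ∈ C)
    (hd : d ∈ C) :
    ∃ ε > 0, ∀ y ∈ Ico c d, ∃ y₀ y₁, c ≤ y₀ ∧ y₀ ≤ y ∧ y < y₁ ∧ y₁ ≤ d ∧ ε ≤ y₁ - y₀ ∧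
      ∀ z ∈ Ioo y₀ y₁, z ∉ C := by
  obtain ⟨ε, hε, hsep⟩ : ∃ ε > 0, ∀ u ∈ C, ∀ v ∈ C, u < v → ε ≤ v - u := by
    have hfin : ((fun p : ℝ × ℝ => p.2 - p.1) '' {p ∈ C ×ˢ C | p.1 < p.2}).Finite :=
      ((hC.prod hC).subset (sep_subset _ _)).image _
    rcases Set.eq_empty_or_nonempty ((fun p : ℝ × ℝ => p.2 - p.1) '' {p ∈ C ×ˢ C | p.1 < p.2})
      with h | h
    · refine ⟨1, one_pos, fun u hu v hv huv => ?_⟩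
      have : v - u ∈ ((fun p : ℝ × ℝ => p.2 - p.1) '' {p ∈ C ×ˢ C | p.1 < p.2}) :=
        ⟨(u, v), ⟨⟨hu, hv⟩, huv⟩, rfl⟩
      exact absurd this (h ▸ notMem_empty _)
    · obtain ⟨_, ⟨p, hp, rfl⟩, hmin⟩ := Set.exists_min_image _ id hfin h
      exact ⟨p.2 - p.1, sub_pos.2 hp.2, fun u hu v hv huv =>
        hmin _ ⟨(u, v), ⟨⟨hu, hv⟩, huv⟩, rfl⟩⟩
  refine ⟨ε, hε, fun y hy => ?_⟩
  obtain ⟨y₀, ⟨hy₀, hy₀y⟩, hmax⟩ := Set.exists_max_image (C ∩ Iic y) id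
    (hC.subset inter_subset_left) ⟨c, hc, hy.1⟩
  obtain ⟨y₁, ⟨hy₁, hyy₁⟩, hmin⟩ := Set.exists_min_image (C ∩ Ioi y) id
    (hC.subset inter_subset_left) ⟨d, hd, hy.2⟩
  refine ⟨y₀, y₁, hmax c ⟨hc, hy.1⟩, hy₀y, hyy₁, hmin d ⟨hd, hy.2⟩,
    hsep _ hy₀ _ hy₁ (lt_of_le_of_lt hy₀y hyy₁), fun z hz hzC => ?_⟩
  rcases le_or_gt z y with h | h
  · exact absurd (hmax z ⟨hzC, h⟩) (not_le.2 hz.1)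
  · exact absurd (hmin z ⟨hzC, h⟩) (not_le.2 hz.2)

/-- If every point of `F` lies in an interval of length at least `ε` contained in `F`, then the
frontier of `F` meets every bounded interval in a finite set. -/
lemma finite_frontier_of_uniform_length {F : Set ℝ} {ε : ℝ} (hε : 0 < ε)
    (hF : ∀ x ∈ F, ∃ u v, x ∈ Ico u v ∧ ε ≤ v - u ∧ Ico u v ⊆ F) :
    (Ioo 0 1 ∩ frontier F).Finite := by
  have key : ∀ p ∈ frontier F, ∀ q ∈ frontier F, ∀ r ∈ frontier F, p < q → q < r →
      ε ≤ r - p := by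
    intro p hp q hq r hr hpq hqr
    by_contra! hlt
    obtain ⟨z, ⟨hpz, hzr⟩, hzF⟩ := mem_closure_iff.1 (frontier_subset_closure hq) (Ioo p r)
      isOpen_Ioo ⟨hpq, hqr⟩
    obtain ⟨u, v, ⟨huz, hzv⟩, huv, hsub⟩ := hF z hzF
    have hint : Ioo u v ⊆ interior F :=
      interior_maximal (Ioo_subset_Ico_self.trans hsub) isOpen_Ioo
    rcases lt_or_ge u p with h | h
    · exact hp.2 (hint ⟨h, hpz.trans hzv⟩)
    · exact hr.2 (hint ⟨lt_of_le_of_lt huz hzr, by linarith⟩)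
  by_contra hinf
  have hfib : ∃ i : ℕ, ((Ioo 0 1 ∩ frontier F) ∩ (fun x => ⌊x / ε⌋₊) ⁻¹' {i}).Infinite := by
    by_contra! hfin
    refine hinf (((Set.finite_Icc 0 ⌊1 / ε⌋₊).biUnion fun i _ =>
      hfin i).subset fun x hx => ?_)
    refine mem_biUnion (x := ⌊x / ε⌋₊) ⟨Nat.zero_le _, Nat.floor_le_floor ?_⟩ ⟨hx, rfl⟩
    gcongr
    exact hx.1.2.le
  obtain ⟨i, hi⟩ := hfib
  obtain ⟨t, ht, htc⟩ := hi.exists_subset_card_eq 3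
  have hm : ∀ j, t.orderEmbOfFin htc j ∈
      ((Ioo 0 1 ∩ frontier F) ∩ (fun x => ⌊x / ε⌋₊) ⁻¹' {i}) :=
    fun j => ht (t.orderEmbOfFin_mem htc j)
  have hlen := key _ (hm 0).1.2 _ (hm 1).1.2 _ (hm 2).1.2
    ((t.orderEmbOfFin htc).strictMono (by decide)) ((t.orderEmbOfFin htc).strictMono (by decide))
  have h1 := Nat.floor_le (div_nonneg (hm 0).1.1.1.le hε.le)
  have h4 := Nat.lt_floor_add_one (t.orderEmbOfFin htc 2 / ε)
  rw [show ⌊t.orderEmbOfFin htc 0 / ε⌋₊ = i from (hm 0).2] at h1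
  rw [show ⌊t.orderEmbOfFin htc 2 / ε⌋₊ = i from (hm 2).2] at h4
  rw [le_div_iff₀ hε] at h1
  rw [div_lt_iff₀ hε] at h4
  linarith

/-- The frontier is transported by local translations. -/
lemma add_mem_frontier {F : Set ℝ} {p t : ℝ} (hp : p ∈ frontier F)
    (h : ∀ᶠ x in nhds p, (x ∈ F ↔ x + t ∈ F)) : p + t ∈ frontier F := by
  have ht : Filter.Tendsto (fun x => x + t) (nhds p) (nhds (p + t)) :=
    (continuous_id.add continuous_const).tendsto p
  rw [frontier_eq_closure_inter_closure] at hp ⊢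
  refine ⟨mem_closure_iff_frequently.2 (ht.frequently ?_),
    mem_closure_iff_frequently.2 (ht.frequently ?_)⟩
  · exact ((mem_closure_iff_frequently.1 hp.1).and_eventually h).mono fun x hx => hx.2.1 hx.1
  · exact ((mem_closure_iff_frequently.1 hp.2).and_eventually h).mono
      fun x hx hxt => hx.1 (hx.2.2 hxt)

namespace IsPiecewiseTranslation

variable {T S : ℝ → ℝ} {D D' : Set ℝ}

lemma iterate_mem (hT : IsPiecewiseTranslation T D) {x : ℝ} (hx : x ∈ Ico (0 : ℝ) 1) (k : ℕ) :
    T^[k] x ∈ Ico (0 : ℝ) 1 :=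
  hT.mapsTo.iterate k hx

lemma injOn_iterate (hT : IsPiecewiseTranslation T D) (k : ℕ) : InjOn T^[k] (Ico 0 1) :=
  hT.injOn.iterate hT.mapsTo k

/-- `T^[k]` is a translation on `[y, z]` if the first `k` images of `(y, z]` avoid `D`. -/
lemma iterate_translation (hT : IsPiecewiseTranslation T D) {y z : ℝ} (hy : 0 ≤ y) (hz : z < 1)
    {m : ℕ} (h : ∀ i < m, ∀ x ∈ Ioc y z, T^[i] x ∉ D) :
    ∀ w ∈ Icc y z, T^[m] w = T^[m] y + (w - y) := by
  induction m with
  | zero => intro w _; simp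
  | succ m ih =>
    have ih' := ih fun i hi => h i (by omega)
    intro w hw
    have hyI : y ∈ Ico (0 : ℝ) 1 := ⟨hy, by linarith [hw.1, hw.2]⟩
    have hwI : w ∈ Ico (0 : ℝ) 1 := ⟨by linarith [hw.1], by linarith [hw.2]⟩
    have e := ih' w hw
    rw [Function.iterate_succ_apply', Function.iterate_succ_apply',
      hT.translation _ (hT.iterate_mem hyI m) _ (hT.iterate_mem hwI m)]
    · rw [e]; ring
    · rw [e]; linarith [hw.1]
    · intro x hx hxD
      rw [e] at hx
      have hx' : y + (x - T^[m] y) ∈ Ioc y z :=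
        ⟨by linarith [hx.1], by linarith [hx.2, hw.2]⟩
      apply h m (by omega) _ hx'
      rwa [ih' _ ⟨hx'.1.le, hx'.2⟩, show T^[m] y + (y + (x - T^[m] y) - y) = x by ring]

/-- The cutting lemma behind the first return map to `[c, d)`: pieces of `[c, d)` of length
bounded below are translated by `T` until they return to `[c, d)`. -/
lemma exists_return_pieces (hT : IsPiecewiseTranslation T D) {c d : ℝ} (hc : 0 ≤ c) (hd : d < 1) :
    ∃ ε > 0, ∀ y ∈ Ico c d, ∃ y₀ y₁, c ≤ y₀ ∧ y₀ ≤ y ∧ y < y₁ ∧ y₁ ≤ d ∧ ε ≤ y₁ - y₀ ∧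
      ∀ k, (∀ i, 0 < i → i < k → T^[i] y ∉ Ico c d) →
        (∀ w ∈ Ico y₀ y₁, T^[k] w = T^[k] y₀ + (w - y₀)) ∧
        ∀ i, 0 < i → i < k → ∀ w ∈ Ico y₀ y₁, T^[i] w ∉ Ico c d := by
  set A : ℝ → Set ℝ := fun q =>
    {z | z ∈ Ico c d ∧ ∃ k, 0 < k ∧ T^[k] z = q ∧ ∀ j, 0 < j → j < k → T^[j] z ∉ Ico c d} with hA
  have hJ : ∀ z ∈ Ico c d, z ∈ Ico (0 : ℝ) 1 := fun z hz =>
    ⟨hc.trans hz.1, hz.2.trans hd⟩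
  have hAsub : ∀ q, (A q).Subsingleton := by
    have aux : ∀ z ∈ Ico c d, ∀ z' ∈ Ico c d, ∀ k l, 0 < k → k ≤ l → T^[k] z = T^[l] z' →
        (∀ j, 0 < j → j < l → T^[j] z' ∉ Ico c d) → z = z' := by
      intro z hz z' hz' k l hk hkl h hl
      obtain ⟨m, rfl⟩ := Nat.exists_eq_add_of_le hkl
      rw [Function.iterate_add_apply] at h
      have h' := hT.injOn_iterate k (hJ z hz) (hT.iterate_mem (hJ z' hz') m) h
      rcases Nat.eq_zero_or_pos m with rfl | hm
      · simpa using h'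
      · exact absurd (h' ▸ hz) (hl m hm (by omega))
    rintro q z ⟨hz, k, hk, hkq, hk'⟩ z' ⟨hz', l, hl, hlq, hl'⟩
    rcases le_total k l with h | h
    · exact aux z hz z' hz' k l hk h (hkq.trans hlq.symm) hl'
    · exact (aux z' hz' z hz l k hl h (hlq.trans hkq.symm) hk').symm
  have hBfin : (D ∪ {c, d}).Finite := hT.finite.union (by simp)
  have hCfin : ((D ∪ {c, d}) ∪ ⋃ q ∈ D ∪ {c, d}, A q).Finite :=
    hBfin.union (hBfin.biUnion fun q _ => (hAsub q).finite)
  obtain ⟨ε, hε, hcut⟩ := hCfin.exists_cut_length (c := c) (d := d) (by simp) (by simp)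
  refine ⟨ε, hε, fun y hy => ?_⟩
  obtain ⟨y₀, y₁, hcy₀, hy₀y, hyy₁, hy₁d, hlen, hC⟩ := hcut y hy
  refine ⟨y₀, y₁, hcy₀, hy₀y, hyy₁, hy₁d, hlen, fun k => ?_⟩
  have hy₀I : y₀ ∈ Ico (0 : ℝ) 1 := hJ _ ⟨hcy₀, by linarith⟩
  induction k with
  | zero => exact fun _ => ⟨fun w _ => by simp, fun i h0 h1 => by omega⟩
  | succ k ih =>
    intro hk
    obtain ⟨htr, hdis⟩ := ih fun i h0 h1 => hk i h0 (by omega)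
    have hno : ∀ q ∈ D ∪ {c, d}, (k = 0 → q ∈ D) → ∀ z ∈ Ioo y₀ y₁, T^[k] z ≠ q := by
      intro q hq hq0 z hz hzq
      rcases Nat.eq_zero_or_pos k with rfl | hk0
      · exact hC z hz (Or.inl (by simpa [← hzq] using hq))
      · exact hC z hz (Or.inr (mem_biUnion hq ⟨⟨by linarith [hz.1], by linarith [hz.2]⟩, k, hk0,
          hzq, fun j h0 h1 => hdis j h0 h1 z ⟨hz.1.le, hz.2⟩⟩))
    have hpull : ∀ q w, w ∈ Ico y₀ y₁ → T^[k] y₀ < q → q ≤ T^[k] w →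
        ∃ z ∈ Ioo y₀ y₁, T^[k] z = q := by
      intro q w hw hq hqw
      rw [htr w hw] at hqw
      have hz : y₀ + (q - T^[k] y₀) ∈ Ioo y₀ y₁ := ⟨by linarith, by linarith [hw.2]⟩
      exact ⟨_, hz, by rw [htr _ ⟨hz.1.le, hz.2⟩]; ring⟩
    constructor
    · intro w hw
      have e := htr w hw
      have hwI : w ∈ Ico (0 : ℝ) 1 := hJ _ ⟨by linarith [hw.1], by linarith [hw.2]⟩
      rw [Function.iterate_succ_apply', Function.iterate_succ_apply',
        hT.translation _ (hT.iterate_mem hy₀I k) _ (hT.iterate_mem hwI k)]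
      · rw [e]; ring
      · rw [e]; linarith [hw.1]
      · intro x hx hxD
        obtain ⟨z, hz, hzx⟩ := hpull x w hw hx.1 hx.2
        exact hno x (Or.inl hxD) (fun _ => hxD) z hz hzx
    · intro i h0 h1 w hw hwJ
      rcases Nat.lt_succ_iff_lt_or_eq.1 h1 with h | rfl
      · exact hdis i h0 h w hw hwJ
      · have hyw : y ∈ Ico y₀ y₁ := ⟨hy₀y, hyy₁⟩
        have hyJ := hk i h0 h1
        have e1 := htr w hw
        have e2 := htr y hyw
        rcases lt_or_ge (T^[i] y) c with h | h
        · obtain ⟨z, hz, hzc⟩ := hpull c w hw (by linarith [hy₀y]) hwJ.1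
          exact hno c (by simp) (fun h => by omega) z hz hzc
        · have h' : d ≤ T^[i] y := by
            by_contra! hlt
            exact hyJ ⟨h, hlt⟩
          obtain ⟨z, hz, hzc⟩ := hpull d y hyw (by linarith [hw.1, hwJ.2]) h'
          exact hno d (by simp) (fun h => by omega) z hz hzc

/-- Every point of `[c, d)` returns to `[c, d)`. -/
lemma exists_return (hT : IsPiecewiseTranslation T D) {c d : ℝ} (hc : 0 ≤ c) (hd : d < 1) {y : ℝ}
    (hy : y ∈ Ico c d) : ∃ k, 0 < k ∧ T^[k] y ∈ Ico c d := by
  by_contra! hno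
  obtain ⟨ε, hε, h⟩ := hT.exists_return_pieces hc hd
  obtain ⟨y₀, y₁, hcy₀, hy₀y, hyy₁, hy₁d, hlen, h⟩ := h y hy
  have hJ : ∀ w ∈ Ico y₀ y₁, w ∈ Ico c d := fun w hw =>
    ⟨by linarith [hw.1], by linarith [hw.2]⟩
  have hI : ∀ w ∈ Ico y₀ y₁, w ∈ Ico (0 : ℝ) 1 := fun w hw =>
    ⟨by linarith [hw.1], by linarith [hw.2]⟩
  have hy₀ : y₀ ∈ Ico y₀ y₁ := ⟨le_rfl, by linarith⟩
  have hdis : ∀ m, 0 < m → ∀ w ∈ Ico y₀ y₁, T^[m] w ∉ Ico c d := fun m hm =>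
    (h (m + 1) fun i h0 _ => hno i h0).2 m hm (by omega)
  obtain ⟨k, l, hkl, hlt⟩ := exists_lt_abs_sub_lt (fun k => hT.iterate_mem (hI _ hy₀) k) hε
  obtain ⟨m, rfl⟩ := Nat.exists_eq_add_of_le hkl.le
  have hm : 0 < m := by omega
  rw [abs_lt] at hlt
  rcases le_total (T^[k] y₀) (T^[k + m] y₀) with hle | hle
  · have hw : y₀ + (T^[k + m] y₀ - T^[k] y₀) ∈ Ico y₀ y₁ := ⟨by linarith, by linarith⟩
    have e := (h k fun i h0 _ => hno i h0).1 _ hw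
    have e' : T^[k] (y₀ + (T^[k + m] y₀ - T^[k] y₀)) = T^[k] (T^[m] y₀) := by
      rw [e, ← Function.iterate_add_apply]; ring
    have := hT.injOn_iterate k (hI _ hw) (hT.iterate_mem (hI _ hy₀) m) e'
    exact hdis m hm y₀ hy₀ (this ▸ hJ _ hw)
  · have hw : y₀ + (T^[k] y₀ - T^[k + m] y₀) ∈ Ico y₀ y₁ := ⟨by linarith, by linarith⟩
    have e := (h (k + m) fun i h0 _ => hno i h0).1 _ hw
    have e' : T^[k] y₀ = T^[k] (T^[m] (y₀ + (T^[k] y₀ - T^[k + m] y₀))) := by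
      rw [← Function.iterate_add_apply, e]; ring
    have := hT.injOn_iterate k (hI _ hy₀) (hT.iterate_mem (hI _ hw) m) e'
    exact hdis m hm _ hw (this ▸ hJ _ hy₀)

/-- A set invariant under `T` in both directions has its frontier points outside `D` mapped by `T`
to frontier points. -/
lemma map_mem_frontier (hT : IsPiecewiseTranslation T D) {F : Set ℝ}
    (hF : ∀ x ∈ Ico (0 : ℝ) 1, (x ∈ F ↔ T x ∈ F)) {p : ℝ} (hp : p ∈ Ioo 0 1 ∩ frontier F)
    (hpD : p ∉ D) : T p ∈ Ioo 0 1 ∩ frontier F := by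
  have hev : ∀ᶠ x in nhds p, x ∈ Ioo (0 : ℝ) 1 ∧ x ∉ D :=
    Filter.Eventually.and (isOpen_Ioo.mem_nhds hp.1)
      (hT.finite.isClosed.isOpen_compl.mem_nhds hpD)
  obtain ⟨η, hη, hball⟩ := Metric.eventually_nhds_iff.1 hev
  have htr : ∀ x, dist x p < η → T x = x + (T p - p) := by
    intro x hx
    have hxI := Ioo_subset_Ico_self (hball hx).1
    have hpI := Ioo_subset_Ico_self hp.1
    rw [Real.dist_eq, abs_lt] at hx
    rcases le_total x p with h | h
    · have := hT.translation x hxI p hpI h fun z hz =>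
        (hball (by rw [Real.dist_eq, abs_lt]; constructor <;> linarith [hz.1, hz.2])).2
      linarith
    · have := hT.translation p hpI x hxI h fun z hz =>
        (hball (by rw [Real.dist_eq, abs_lt]; constructor <;> linarith [hz.1, hz.2])).2
      linarith
  refine ⟨⟨?_, (hT.mapsTo (Ioo_subset_Ico_self hp.1)).2⟩, ?_⟩
  · have hd : dist (p - η / 2) p < η := by
      rw [Real.dist_eq, abs_lt]; constructor <;> linarith
    have := (hT.mapsTo (Ioo_subset_Ico_self (hball hd).1)).1
    rw [htr _ hd] at this
    linarith
  · rw [show T p = p + (T p - p) by ring]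
    refine add_mem_frontier hp.2 (Metric.eventually_nhds_iff.2 ⟨η, hη, fun x hx => ?_⟩)
    rw [← htr x hx]
    exact hF x (Ioo_subset_Ico_self (hball hx).1)

lemma finite_preimage_iterate (hT : IsPiecewiseTranslation T D) (i : ℕ) :
    (Ico 0 1 ∩ T^[i] ⁻¹' D).Finite :=
  Set.Finite.of_finite_image (hT.finite.subset (by rintro _ ⟨x, hx, rfl⟩; exact hx.2))
    ((hT.injOn_iterate i).mono inter_subset_left)

/-- If no point of `D` returns to `D`, and `0` is the image of a point of `D`, then there is no
periodic point. -/
lemma iterate_ne_self (hT : IsPiecewiseTranslation T D) (hDI : D ⊆ Ico 0 1)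
    (hK : ∀ x ∈ D, ∀ k, 0 < k → T^[k] x ∉ D) (h0 : ∃ b ∈ D, T b = 0) {p : ℝ}
    (hp : p ∈ Ico (0 : ℝ) 1) {m : ℕ} (hm : 0 < m) : T^[m] p ≠ p := by
  intro hper
  have hDper : ∀ x ∈ D, T^[m] x ≠ x := fun x hx h => hK x hx m hm (h.symm ▸ hx)
  have hfin : ({0} ∪ ⋃ i ∈ Iio m, Ico 0 1 ∩ T^[i] ⁻¹' D).Finite :=
    (Set.finite_singleton 0).union ((Set.finite_Iio m).biUnion fun i _ =>
      hT.finite_preimage_iterate i)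
  obtain ⟨y, ⟨hy, hyp⟩, hmax⟩ := Set.exists_max_image
    (({0} ∪ ⋃ i ∈ Iio m, Ico 0 1 ∩ T^[i] ⁻¹' D) ∩ Iic p) id
    (hfin.subset inter_subset_left) ⟨0, by simp, hp.1⟩
  have hy0 : 0 ≤ y := hmax 0 ⟨by simp, hp.1⟩
  have hyI : y ∈ Ico (0 : ℝ) 1 := ⟨hy0, lt_of_le_of_lt hyp hp.2⟩
  have e := hT.iterate_translation hy0 hp.2 (m := m) (z := p) (fun i hi x hx hxD =>
    absurd (hmax x ⟨Or.inr (mem_biUnion (mem_Iio.2 hi)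
      ⟨⟨by linarith [hx.1], by linarith [hx.2, hp.2]⟩, hxD⟩), hx.2⟩) (not_le.2 hx.1)) p ⟨hyp, le_rfl⟩
  have hyper : T^[m] y = y := by linarith
  rcases hy with hy | hy
  · obtain ⟨b, hb, hTb⟩ := h0
    rw [mem_singleton_iff.1 hy, ← hTb, ← Function.iterate_succ_apply,
      Function.iterate_succ_apply'] at hyper
    exact hDper b hb (hT.injOn (hT.iterate_mem (hDI hb) m) (hDI hb) hyper)
  · simp only [mem_iUnion, mem_inter_iff, mem_preimage] at hy
    obtain ⟨i, _, _, hi⟩ := hy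
    refine hDper _ hi ?_
    rw [← Function.iterate_add_apply, Nat.add_comm, Function.iterate_add_apply, hyper]

/-- Abstract minimality: the forward orbit of every point visits every interval. -/
theorem exists_iterate_mem (hT : IsPiecewiseTranslation T D) (hS : IsPiecewiseTranslation S D')
    (hST : ∀ x ∈ Ico (0 : ℝ) 1, S (T x) = x) (hTS : ∀ x ∈ Ico (0 : ℝ) 1, T (S x) = x)
    (hDI : D ⊆ Ico 0 1) (hK : ∀ x ∈ D, ∀ k, 0 < k → T^[k] x ∉ D) (h0 : ∃ b ∈ D, T b = 0)
    (hD' : D' ⊆ T '' insert 0 D) {c d : ℝ} (hc : 0 < c) (hcd : c < d) (hd : d < 1) :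
    ∀ x ∈ Ico (0 : ℝ) 1, ∃ k, T^[k] x ∈ Ico c d := by
  by_contra! hne
  obtain ⟨x₀, hx₀, hx₀'⟩ := hne
  have hTSk : ∀ k, ∀ x ∈ Ico (0 : ℝ) 1, T^[k] (S^[k] x) = x := by
    intro k
    induction k with
    | zero => simp
    | succ k ih =>
      intro x hx
      rw [Function.iterate_succ_apply, Function.iterate_succ_apply',
        hTS _ (hS.iterate_mem hx k), ih x hx]
  have hSTk : ∀ k, ∀ x ∈ Ico (0 : ℝ) 1, S^[k] (T^[k] x) = x := by
    intro k
    induction k with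
    | zero => simp
    | succ k ih =>
      intro x hx
      rw [Function.iterate_succ_apply, Function.iterate_succ_apply',
        hST _ (hT.iterate_mem hx k), ih x hx]
  set F : Set ℝ := {x | x ∈ Ico (0 : ℝ) 1 ∧ ∃ k, T^[k] x ∈ Ico c d} with hFdef
  have hFT : ∀ x ∈ Ico (0 : ℝ) 1, (x ∈ F ↔ T x ∈ F) := by
    intro x hx
    constructor
    · rintro ⟨_, k, hk⟩
      refine ⟨hT.mapsTo hx, ?_⟩
      cases k with
      | zero =>
        obtain ⟨l, hl, hlJ⟩ := hT.exists_return hc.le hd hk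
        obtain ⟨l, rfl⟩ := Nat.exists_eq_add_of_lt hl
        exact ⟨l, by simpa using hlJ⟩
      | succ k => exact ⟨k, hk⟩
    · rintro ⟨_, k, hk⟩
      exact ⟨hx, k + 1, hk⟩
  have hFS : ∀ x ∈ Ico (0 : ℝ) 1, (x ∈ F ↔ S x ∈ F) := by
    intro x hx
    rw [hFT _ (hS.mapsTo hx), hTS x hx]
  obtain ⟨ε, hε, hpieces⟩ := hS.exists_return_pieces hc.le hd
  have hlen : ∀ x ∈ F, ∃ u v, x ∈ Ico u v ∧ ε ≤ v - u ∧ Ico u v ⊆ F := by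
    classical
    rintro x ⟨hx, hex⟩
    set k := Nat.find hex with hk
    have hkJ : T^[k] x ∈ Ico c d := Nat.find_spec hex
    obtain ⟨y₀, y₁, hcy₀, hy₀y, hyy₁, hy₁d, hlen, h⟩ := hpieces _ hkJ
    have htr := (h k (fun i h0 h1 hi => by
      obtain ⟨m, hm⟩ := Nat.exists_eq_add_of_le h1.le
      rw [hm, Function.iterate_add_apply, hSTk i _ (hT.iterate_mem hx m)] at hi
      exact Nat.find_min hex (by omega : m < k) hi)).1
    have hIy : ∀ w ∈ Ico y₀ y₁, w ∈ Ico c d ∧ w ∈ Ico (0 : ℝ) 1 := fun w hw =>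
      ⟨⟨by linarith [hw.1], by linarith [hw.2]⟩, ⟨by linarith [hw.1], by linarith [hw.2]⟩⟩
    refine ⟨S^[k] y₀, S^[k] y₀ + (y₁ - y₀), ?_, by linarith, ?_⟩
    · have := htr _ ⟨hy₀y, hyy₁⟩
      rw [hSTk k x hx] at this
      rw [this]
      exact ⟨by linarith, by linarith⟩
    · intro z hz
      have hw : y₀ + (z - S^[k] y₀) ∈ Ico y₀ y₁ := ⟨by linarith [hz.1], by linarith [hz.2]⟩
      have e : z = S^[k] (y₀ + (z - S^[k] y₀)) := by rw [htr _ hw]; ring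
      rw [e]
      refine ⟨hS.iterate_mem (hIy _ hw).2 k, k, ?_⟩
      rw [hTSk k _ (hIy _ hw).2]
      exact (hIy _ hw).1
  have hEfin := finite_frontier_of_uniform_length hε hlen
  have hnp : ∀ p ∈ Ico (0 : ℝ) 1, ∀ m, 0 < m → T^[m] p ≠ p := fun p hp m hm =>
    hT.iterate_ne_self hDI hK h0 hp hm
  obtain ⟨x, hx, hxF⟩ : ∃ x ∈ Ioo (0 : ℝ) 1, x ∉ F := by
    have hx₀F : x₀ ∉ F := fun h => h.2.elim hx₀'
    rcases hx₀.1.eq_or_lt with h | h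
    · refine ⟨T x₀, ⟨?_, (hT.mapsTo hx₀).2⟩, fun h' => hx₀F ((hFT _ hx₀).2 h')⟩
      refine lt_of_le_of_ne (hT.mapsTo hx₀).1 fun h' => hnp x₀ hx₀ 1 one_pos ?_
      rw [Function.iterate_one, ← h', h]
    · exact ⟨x₀, ⟨h, hx₀.2⟩, hx₀F⟩
  have hcF : c ∈ F := ⟨⟨hc.le, hcd.trans hd⟩, 0, le_rfl, hcd⟩
  obtain ⟨p, hp⟩ : (Ioo 0 1 ∩ frontier F).Nonempty := by
    by_contra hemp
    have hout : ∀ z ∈ Ioo (0 : ℝ) 1, z ∉ frontier F := fun z hz hzf => hemp ⟨z, hz, hzf⟩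
    have hin : ∀ z ∈ Ioo (0 : ℝ) 1, z ∈ F → z ∈ interior F := fun z hz hzF => by
      by_contra h
      exact hout z hz ⟨subset_closure hzF, h⟩
    have hin' : ∀ z ∈ Ioo (0 : ℝ) 1, z ∉ F → z ∈ interior Fᶜ := fun z hz hzF => by
      by_contra h
      exact hout z hz (frontier_compl F ▸ ⟨subset_closure hzF, h⟩)
    obtain ⟨z, _, hz, hz'⟩ := isPreconnected_Ioo (interior F) (interior Fᶜ) isOpen_interior
      isOpen_interior (fun z hz => (em (z ∈ F)).imp (hin z hz) (hin' z hz))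
      ⟨c, ⟨hc, hcd.trans hd⟩, hin c ⟨hc, hcd.trans hd⟩ hcF⟩ ⟨x, hx, hin' x hx hxF⟩
    exact interior_subset hz' (interior_subset hz)
  have hpI := Ioo_subset_Ico_self hp.1
  by_cases hhit : ∃ k, T^[k] p ∈ D
  · obtain ⟨k, hk⟩ := hhit
    have hback : ∀ j, S^[j] p ∉ D' := by
      intro j hj
      obtain ⟨b, hb, hbj⟩ := hD' hj
      have hbI : b ∈ Ico (0 : ℝ) 1 := by
        rcases hb with rfl | hb
        · simp
        · exact hDI hb
      have e : T^[k + j + 1] b = T^[k] p := by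
        rw [Function.iterate_succ_apply, hbj, Function.iterate_add_apply, hTSk j p hpI]
      rcases hb with rfl | hb
      · obtain ⟨b, hb, hTb⟩ := h0
        rw [← hTb, ← Function.iterate_succ_apply] at e
        exact hK b hb _ (Nat.succ_pos _) (e ▸ hk)
      · exact hK b hb _ (Nat.succ_pos _) (e ▸ hk)
    have hE : ∀ j, S^[j] p ∈ Ioo 0 1 ∩ frontier F := by
      intro j
      induction j with
      | zero => exact hp
      | succ j ih =>
        rw [Function.iterate_succ_apply']
        exact hS.map_mem_frontier hFS ih (hback j)
    obtain ⟨i, j, hij, h⟩ := hEfin.exists_lt_map_eq_of_forall_mem hE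
    obtain ⟨m, rfl⟩ := Nat.exists_eq_add_of_le hij.le
    refine hnp p hpI m (by omega) ?_
    have h' := hS.injOn_iterate i hpI (hS.iterate_mem hpI m)
      (h.trans (Function.iterate_add_apply S i m p))
    have h'' := hTSk m p hpI
    rwa [← h'] at h''
  · push Not at hhit
    have hE : ∀ j, T^[j] p ∈ Ioo 0 1 ∩ frontier F := by
      intro j
      induction j with
      | zero => exact hp
      | succ j ih =>
        rw [Function.iterate_succ_apply']
        exact hT.map_mem_frontier hFT ih (hhit j)
    obtain ⟨i, j, hij, h⟩ := hEfin.exists_lt_map_eq_of_forall_mem hE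
    obtain ⟨m, rfl⟩ := Nat.exists_eq_add_of_le hij.le
    exact hnp p hpI m (by omega) (hT.injOn_iterate i hpI (hT.iterate_mem hpI m)
      (h.trans (Function.iterate_add_apply T i m p))).symm

end IsPiecewiseTranslation

section Concrete

variable {n : ℕ} {a : Fin n → ℝ} {τ : Equiv.Perm (Fin n)} {T S : ℝ → ℝ}

lemma bpt_zero (a : Fin n → ℝ) : bpt a 0 = 0 := by simp [bpt]

lemma bpt_succ (a : Fin n → ℝ) (i : Fin n) : bpt a ((i : ℕ) + 1) = bpt a i + a i := by
  have h : Finset.univ.filter (fun j : Fin n => (j : ℕ) < (i : ℕ) + 1) =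
      insert i (Finset.univ.filter (fun j : Fin n => (j : ℕ) < i)) := by
    ext j
    simp only [Finset.mem_filter, Finset.mem_univ, true_and, Finset.mem_insert, Fin.ext_iff]
    omega
  rw [bpt, h, Finset.sum_insert (by simp), add_comm, bpt]

lemma IsProbVec.bpt_card (ha : IsProbVec a) : bpt a n = 1 := by
  simp [bpt, ha.2]

lemma IsProbVec.bpt_mono (ha : IsProbVec a) : Monotone (bpt a) := fun _ _ hkl =>
  Finset.sum_le_sum_of_subset_of_nonneg
    (Finset.monotone_filter_right _ fun _ _ h => lt_of_lt_of_le h hkl) fun i _ _ => (ha.1 i).le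

lemma IsProbVec.bpt_lt (ha : IsProbVec a) {k l : ℕ} (hkl : k < l) (hk : k < n) :
    bpt a k < bpt a l := by
  have h := ha.bpt_mono (Nat.succ_le_of_lt hkl)
  have h' := bpt_succ a ⟨k, hk⟩
  have h'' := ha.1 ⟨k, hk⟩
  simp only [Nat.succ_eq_add_one] at h h'
  linarith

lemma IsProbVec.aperm (ha : IsProbVec a) (τ : Equiv.Perm (Fin n)) : IsProbVec (aperm a τ) :=
  ⟨fun _ => ha.1 _, (Equiv.sum_comp τ.symm a).trans ha.2⟩

lemma IsProbVec.Dset_subset (ha : IsProbVec a) : Dset a ⊆ Ioo 0 1 := by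
  rintro _ ⟨k, hk, hkn, rfl⟩
  exact ⟨bpt_zero a ▸ ha.bpt_lt hk (by omega), ha.bpt_card ▸ ha.bpt_lt hkn hkn⟩

lemma Dset_finite (a : Fin n → ℝ) : (Dset a).Finite :=
  ((Set.finite_Iio n).image (bpt a)).subset (by
    rintro _ ⟨k, _, hkn, rfl⟩
    exact ⟨k, hkn, rfl⟩)

lemma IsProbVec.Jint_subset (ha : IsProbVec a) (i : Fin n) : Jint a i ⊆ Ico 0 1 := fun _ hx =>
  ⟨(bpt_zero a ▸ ha.bpt_mono (Nat.zero_le i)).trans hx.1,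
    hx.2.trans_le (ha.bpt_card ▸ ha.bpt_mono (Nat.succ_le_of_lt i.2))⟩

lemma IsProbVec.left_mem_Jint (ha : IsProbVec a) (i : Fin n) : bpt a i ∈ Jint a i :=
  ⟨le_rfl, ha.bpt_lt (Nat.lt_succ_self _) i.2⟩

lemma IsProbVec.exists_mem_Jint (ha : IsProbVec a) {x : ℝ} (hx : x ∈ Ico (0 : ℝ) 1) :
    ∃ i, x ∈ Jint a i := by
  classical
  have hex : ∃ k, x < bpt a k := ⟨n, ha.bpt_card.symm ▸ hx.2⟩
  obtain ⟨k, hk⟩ : ∃ k, Nat.find hex = k + 1 := Nat.exists_eq_succ_of_ne_zero fun h => by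
    have := Nat.find_spec hex
    rw [h, bpt_zero] at this
    exact absurd hx.1 (not_le.2 this)
  have hle : Nat.find hex ≤ n := Nat.find_min' hex (ha.bpt_card.symm ▸ hx.2)
  exact ⟨⟨k, by omega⟩, not_lt.1 (Nat.find_min hex (lt_of_lt_of_eq k.lt_succ_self hk.symm)), hk ▸ Nat.find_spec hex⟩

lemma IsProbVec.exists_mem_Jtil (ha : IsProbVec a) {x : ℝ} (hx : x ∈ Ioc (0 : ℝ) 1) :
    ∃ i, x ∈ Jtil a i := by
  classical
  have hex : ∃ k, x ≤ bpt a k := ⟨n, ha.bpt_card.symm ▸ hx.2⟩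
  obtain ⟨k, hk⟩ : ∃ k, Nat.find hex = k + 1 := Nat.exists_eq_succ_of_ne_zero fun h => by
    have := Nat.find_spec hex
    rw [h, bpt_zero] at this
    exact absurd hx.1 (not_lt.2 this)
  have hle : Nat.find hex ≤ n := Nat.find_min' hex (ha.bpt_card.symm ▸ hx.2)
  exact ⟨⟨k, by omega⟩, not_le.1 (Nat.find_min hex (lt_of_lt_of_eq k.lt_succ_self hk.symm)), hk ▸ Nat.find_spec hex⟩

lemma IsProbVec.Jint_unique (ha : IsProbVec a) {x : ℝ} {i j : Fin n} (hi : x ∈ Jint a i)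
    (hj : x ∈ Jint a j) : i = j := by
  by_contra hne
  rcases lt_or_gt_of_ne hne with h | h
  · exact absurd (ha.bpt_mono (Nat.succ_le_of_lt (Fin.lt_def.1 h))) (not_le.2 (hj.1.trans_lt hi.2))
  · exact absurd (ha.bpt_mono (Nat.succ_le_of_lt (Fin.lt_def.1 h))) (not_le.2 (hi.1.trans_lt hj.2))

lemma aperm_aperm_symm (a : Fin n → ℝ) (τ : Equiv.Perm (Fin n)) :
    aperm (aperm a τ) τ.symm = a := by
  ext j; simp [aperm]

lemma IsProbVec.exists_isLrIET (ha : IsProbVec a) (τ : Equiv.Perm (Fin n)) :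
    ∃ T, IsLrIET a τ T := by
  classical
  refine ⟨fun x => if h : ∃ i, x ∈ Jint a i then
    x - bpt a h.choose + bpt (_root_.aperm a τ) (τ h.choose) else 0, fun i x hx => ?_⟩
  have h : ∃ i, x ∈ Jint a i := ⟨i, hx⟩
  simp only [dif_pos h, ha.Jint_unique h.choose_spec hx]

lemma IsLrIET.map_mem_Jint (hT : IsLrIET a τ T) {i : Fin n} {x : ℝ} (hx : x ∈ Jint a i) :
    T x ∈ Jint (aperm a τ) (τ i) := by
  rw [hT i x hx, Jint, bpt_succ]
  have h := hx.2
  rw [bpt_succ] at h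
  have h' : aperm a τ (τ i) = a i := by simp [aperm]
  exact ⟨by linarith [hx.1], by linarith⟩

lemma IsLrIET.leftInverse (ha : IsProbVec a) (hT : IsLrIET a τ T)
    (hS : IsLrIET (aperm a τ) τ.symm S) {x : ℝ} (hx : x ∈ Ico (0 : ℝ) 1) : S (T x) = x := by
  obtain ⟨i, hi⟩ := ha.exists_mem_Jint hx
  rw [hS _ _ (hT.map_mem_Jint hi), hT i x hi, aperm_aperm_symm, Equiv.symm_apply_apply]
  ring

lemma IsLrIET.symm_symm (hT : IsLrIET a τ T) :
    IsLrIET (aperm (aperm a τ) τ.symm) τ.symm.symm T := by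
  rwa [aperm_aperm_symm, Equiv.symm_symm]

lemma IsLrIET.isPiecewiseTranslation (ha : IsProbVec a) (hT : IsLrIET a τ T) :
    IsPiecewiseTranslation T (Dset a) where
  mapsTo x hx := by
    obtain ⟨i, hi⟩ := ha.exists_mem_Jint hx
    exact (ha.aperm τ).Jint_subset _ (hT.map_mem_Jint hi)
  injOn x hx y hy h := by
    obtain ⟨S, hS⟩ := (ha.aperm τ).exists_isLrIET τ.symm
    rw [← hT.leftInverse ha hS hx, h, hT.leftInverse ha hS hy]
  finite := Dset_finite a
  translation y hy z hz hyz h := by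
    obtain ⟨i, hi⟩ := ha.exists_mem_Jint hy
    have hzi : z ∈ Jint a i := by
      refine ⟨hi.1.trans hyz, ?_⟩
      by_contra! hle
      refine h _ ⟨hi.2, hle⟩ ⟨i + 1, Nat.succ_pos _, ?_, rfl⟩
      refine lt_of_le_of_ne (Nat.succ_le_of_lt i.2) fun hn => ?_
      rw [hn, ha.bpt_card] at hle
      exact absurd hz.2 (not_lt.2 hle)
    rw [hT i y hi, hT i z hzi]
    ring

lemma IsLrIET.map_bpt (ha : IsProbVec a) (hT : IsLrIET a τ T) (i : Fin n) :
    T (bpt a i) = bpt (aperm a τ) (τ i) := by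
  rw [hT i _ (ha.left_mem_Jint i)]
  ring

lemma KeaneCond.iterate_notMem (hK : KeaneCond a T) {x : ℝ} (hx : x ∈ Dset a) {k : ℕ}
    (hk : 0 < k) : T^[k] x ∉ Dset a := fun h =>
  (hK k hk).le ⟨h, x, hx, rfl⟩

lemma IsLrIET.exists_map_eq_zero (ha : IsProbVec a) (hT : IsLrIET a τ T) (hn : 2 ≤ n)
    (hirr : IrreduciblePerm τ) : ∃ b ∈ Dset a, T b = 0 := by
  have hn0 : 0 < n := by omega
  set i := τ.symm ⟨0, hn0⟩ with hi
  have hτi : τ i = ⟨0, hn0⟩ := by simp [hi]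
  refine ⟨bpt a i, ⟨i, Nat.pos_of_ne_zero fun h => ?_, i.2, rfl⟩, ?_⟩
  · refine hirr 1 one_pos (by omega) ?_
    have hset : {i : Fin n | (i : ℕ) < 1} = {⟨0, hn0⟩} := by
      ext j; simp [Fin.ext_iff]
    rw [hset, image_singleton]
    rw [show i = ⟨0, hn0⟩ from Fin.ext h] at hτi
    simp only [hτi]
  · rw [hT.map_bpt ha, hτi, bpt_zero]

lemma IsLrIET.Dset_aperm_subset (ha : IsProbVec a) (hT : IsLrIET a τ T) :
    Dset (aperm a τ) ⊆ T '' insert 0 (Dset a) := by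
  rintro _ ⟨k, hk, hkn, rfl⟩
  refine ⟨bpt a (τ.symm ⟨k, hkn⟩), ?_, by rw [hT.map_bpt ha]; simp⟩
  rcases Nat.eq_zero_or_pos (τ.symm ⟨k, hkn⟩ : ℕ) with h | h
  · exact Or.inl (by rw [h, bpt_zero])
  · exact Or.inr ⟨_, h, Fin.is_lt _, rfl⟩

/-- Forward orbits of an irreducible interval exchange satisfying the Keane Condition visit every
interval. -/
theorem IsLrIET.exists_iterate_mem (ha : IsProbVec a) (hT : IsLrIET a τ T) (hn : 2 ≤ n)
    (hirr : IrreduciblePerm τ) (hK : KeaneCond a T) {c d : ℝ} (hc : 0 < c) (hcd : c < d)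
    (hd : d < 1) {x : ℝ} (hx : x ∈ Ico (0 : ℝ) 1) : ∃ k, T^[k] x ∈ Ico c d := by
  obtain ⟨S, hS⟩ := (ha.aperm τ).exists_isLrIET τ.symm
  exact (hT.isPiecewiseTranslation ha).exists_iterate_mem (hS.isPiecewiseTranslation (ha.aperm τ))
    (fun _ hx => hT.leftInverse ha hS hx)
    (fun _ hx => hS.leftInverse (ha.aperm τ) hT.symm_symm hx)
    (ha.Dset_subset.trans Ioo_subset_Ico_self) (fun _ hx _ hk => hK.iterate_notMem hx hk)
    (hT.exists_map_eq_zero ha hn hirr) (hT.Dset_aperm_subset ha) hc hcd hd x hx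

lemma IsLrIET.iterate_ne_self (ha : IsProbVec a) (hT : IsLrIET a τ T) (hn : 2 ≤ n)
    (hirr : IrreduciblePerm τ) (hK : KeaneCond a T) {x : ℝ} (hx : x ∈ Ico (0 : ℝ) 1) {m : ℕ}
    (hm : 0 < m) : T^[m] x ≠ x :=
  (hT.isPiecewiseTranslation ha).iterate_ne_self (ha.Dset_subset.trans Ioo_subset_Ico_self)
    (fun _ hx _ hk => hK.iterate_notMem hx hk) (hT.exists_map_eq_zero ha hn hirr) hx hm

variable {Tt : ℝ → ℝ}

lemma IslRIET.eq_of_mem_Ioo (hTt : IslRIET a τ Tt) (hT : IsLrIET a τ T) {i : Fin n} {x : ℝ}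
    (hx : x ∈ Ioo (bpt a i) (bpt a (i + 1))) : Tt x = T x := by
  rw [hTt i x (Ioo_subset_Ioc_self hx), hT i x (Ioo_subset_Ico_self hx)]

lemma IslRIET.eq_of_notMem (ha : IsProbVec a) (hTt : IslRIET a τ Tt) (hT : IsLrIET a τ T) {x : ℝ}
    (hx : x ∈ Ioc (0 : ℝ) 1) (hxD : x ∉ insert 1 (Dset a)) : Tt x = T x := by
  obtain ⟨i, hi⟩ := ha.exists_mem_Jtil hx
  refine hTt.eq_of_mem_Ioo hT ⟨hi.1, lt_of_le_of_ne hi.2 fun h => hxD ?_⟩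
  rcases (Nat.succ_le_of_lt i.2).lt_or_eq with hn | hn
  · exact Or.inr ⟨_, Nat.succ_pos _, hn, h⟩
  · exact Or.inl (h.trans ((congrArg (bpt a) hn).trans ha.bpt_card))

/-- To the left of every point, iterates of the dual transformation are limits of iterates of the
original one. -/
lemma IslRIET.exists_left_iterate_eq (ha : IsProbVec a) (hTt : IslRIET a τ Tt)
    (hT : IsLrIET a τ T) (hmaps : MapsTo Tt (Ioc 0 1) (Ioc 0 1)) {p : ℝ}
    (hp : p ∈ Ioc (0 : ℝ) 1) (m : ℕ) :
    ∃ η > 0, ∀ w ∈ Ioo (p - η) p, T^[m] w = Tt^[m] p - (p - w) := by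
  induction m with
  | zero => exact ⟨1, one_pos, fun w _ => by simp⟩
  | succ m ih =>
    obtain ⟨η, hη, h⟩ := ih
    obtain ⟨i, hi⟩ := ha.exists_mem_Jtil (hmaps.iterate m hp)
    refine ⟨min η (Tt^[m] p - bpt a i), lt_min hη (sub_pos.2 hi.1), fun w hw => ?_⟩
    have h1 := min_le_left η (Tt^[m] p - bpt a i)
    have h2 := min_le_right η (Tt^[m] p - bpt a i)
    have e := h w ⟨by linarith [hw.1], hw.2⟩
    have hwi : T^[m] w ∈ Jint a i := by
      rw [e]
      exact ⟨by linarith [hw.1], by linarith [hw.2, hi.2]⟩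
    rw [Function.iterate_succ_apply', Function.iterate_succ_apply', hT i _ hwi, hTt i _ hi, e]
    ring

lemma IslRIET.iterate_ne_self (ha : IsProbVec a) (hTt : IslRIET a τ Tt) (hT : IsLrIET a τ T)
    (hmaps : MapsTo Tt (Ioc 0 1) (Ioc 0 1)) (hn : 2 ≤ n) (hirr : IrreduciblePerm τ)
    (hK : KeaneCond a T) {p : ℝ} (hp : p ∈ Ioc (0 : ℝ) 1) {m : ℕ} (hm : 0 < m) :
    Tt^[m] p ≠ p := by
  intro hper
  obtain ⟨η, hη, h⟩ := hTt.exists_left_iterate_eq ha hT hmaps hp m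
  obtain ⟨w, hw, hwp⟩ := exists_between (max_lt (sub_lt_self p hη) hp.1)
  refine hT.iterate_ne_self ha hn hirr hK (x := w)
    ⟨(le_max_right _ _).trans hw.le, hwp.trans_le hp.2⟩ hm ?_
  rw [h w ⟨(le_max_left _ _).trans_lt hw, hwp⟩, hper]
  ring

/-- Forward orbits of the dual of an irreducible interval exchange satisfying the Keane Condition
visit every interval. -/
theorem IslRIET.exists_iterate_mem (ha : IsProbVec a) (hTt : IslRIET a τ Tt)
    (hT : IsLrIET a τ T) (hmaps : MapsTo Tt (Ioc 0 1) (Ioc 0 1)) (hn : 2 ≤ n)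
    (hirr : IrreduciblePerm τ) (hK : KeaneCond a T) {c d : ℝ} (hc : 0 < c) (hcd : c < d)
    (hd : d < 1) {x : ℝ} (hx : x ∈ Ioc (0 : ℝ) 1) : ∃ k, Tt^[k] x ∈ Ico c d := by
  have hinj : Function.Injective fun k => Tt^[k] x := by
    have aux : ∀ k l, k < l → Tt^[k] x ≠ Tt^[l] x := fun k l hkl h => by
      obtain ⟨m, rfl⟩ := Nat.exists_eq_add_of_le hkl.le
      rw [Nat.add_comm, Function.iterate_add_apply] at h
      exact hTt.iterate_ne_self ha hT hmaps hn hirr hK (hmaps.iterate k hx) (by omega) h.symm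
    intro k l h
    rcases lt_trichotomy k l with hkl | hkl | hkl
    · exact absurd h (aux k l hkl)
    · exact hkl
    · exact absurd h.symm (aux l k hkl)
  obtain ⟨K, hK'⟩ := (((Dset_finite a).insert 1).preimage hinj.injOn).bddAbove
  have hout : ∀ k, Tt^[k] (Tt^[K + 1] x) ∉ insert 1 (Dset a) := fun k h => by
    rw [← Function.iterate_add_apply] at h
    have : k + (K + 1) ≤ K := hK' h
    omega
  set y := Tt^[K + 1] x with hy
  have hyI : y ∈ Ioc (0 : ℝ) 1 := hmaps.iterate _ hx
  have heq : ∀ k, Tt^[k] y = T^[k] y := by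
    intro k
    induction k with
    | zero => rfl
    | succ k ih =>
      rw [Function.iterate_succ_apply', Function.iterate_succ_apply', ← ih]
      exact hTt.eq_of_notMem ha hT (hmaps.iterate k hyI) (hout k)
  obtain ⟨k, hk⟩ := hT.exists_iterate_mem ha hn hirr hK hc hcd hd (x := y)
    ⟨hyI.1.le, lt_of_le_of_ne hyI.2 fun h => hout 0 (Or.inl h)⟩
  exact ⟨k + (K + 1), by rwa [Function.iterate_add_apply, ← hy, heq]⟩

end Concrete

lemma Icc_subset_closure_of_meets_Ico {A : Set ℝ}
    (h : ∀ c d : ℝ, 0 < c → c < d → d < 1 → ∃ y ∈ A, y ∈ Ico c d) : Icc 0 1 ⊆ closure A := by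
  rw [← closure_Ioo (zero_ne_one' ℝ)]
  refine closure_minimal (fun x hx => Metric.mem_closure_iff.2 fun ε hε => ?_) isClosed_closure
  obtain ⟨d, hxd, hd⟩ := exists_between (lt_min hx.2 (lt_add_of_pos_right x hε))
  obtain ⟨y, hyA, hy⟩ := h x d hx.1 hxd (hd.trans_le (min_le_left _ _))
  refine ⟨y, hyA, ?_⟩
  rw [Real.dist_eq, abs_lt]
  constructor <;> linarith [hy.1, hy.2, min_le_right 1 (x + ε)]

lemma natCast_iter_eq_iterate {f : ℝ → ℝ} {P : ℤ → ℝ → ℝ} {x : ℝ} (h0 : P 0 x = x)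
    (h : ∀ k, P (k + 1) x = f (P k x)) (k : ℕ) : P k x = f^[k] x := by
  induction k with
  | zero => simpa using h0
  | succ k ih => rw [Function.iterate_succ_apply', ← ih, ← h, Nat.cast_succ]

/-- Keane's Theorem 3.4: if `T` is irreducible and satisfies the
Keane Condition, then `T` and `T̃` are minimal: every `T`-orbit `{T^k x : k ∈ ℤ}`
is dense in `[0,1)` and every `T̃`-orbit is dense in `(0,1]`. -/
theorem stmt8 {n : ℕ} (hn : 2 ≤ n) (a : Fin n → ℝ) (ha : IsProbVec a)
    (τ : Equiv.Perm (Fin n)) (T Tt : ℝ → ℝ)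
    (hT : IsLrIET a τ T) (hTt : IslRIET a τ Tt)
    (P Pt : ℤ → ℝ → ℝ) (hP : IsZIterLr T P) (hPt : IsZIterlR Tt Pt)
    (hirr : IrreduciblePerm τ) (hKeane : KeaneCond a T) :
    (∀ x ∈ Set.Ico (0 : ℝ) 1,
      Set.Ico (0 : ℝ) 1 ⊆ closure {y : ℝ | ∃ k : ℤ, P k x = y}) ∧
    (∀ x ∈ Set.Ioc (0 : ℝ) 1,
      Set.Ioc (0 : ℝ) 1 ⊆ closure {y : ℝ | ∃ k : ℤ, Pt k x = y}) := by
  constructor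
  · intro x hx
    refine Ico_subset_Icc_self.trans (Icc_subset_closure_of_meets_Ico fun c d hc hcd hd => ?_)
    obtain ⟨k, hk⟩ := hT.exists_iterate_mem ha hn hirr hKeane hc hcd hd hx
    exact ⟨_, ⟨k, natCast_iter_eq_iterate (hP.1 x hx) (fun k => (hP.2 k x hx).2) k⟩, hk⟩
  · intro x hx
    have hmaps : MapsTo Tt (Ioc 0 1) (Ioc 0 1) := fun y hy => by
      have h := (hPt.2 0 y hy).2
      rw [hPt.1 y hy] at h
      exact h ▸ (hPt.2 (0 + 1) y hy).1
    refine Ioc_subset_Icc_self.trans (Icc_subset_closure_of_meets_Ico fun c d hc hcd hd => ?_)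
    obtain ⟨k, hk⟩ := hTt.exists_iterate_mem ha hT hmaps hn hirr hKeane hc hcd hd hx
    exact ⟨_, ⟨k, natCast_iter_eq_iterate (hPt.1 x hx) (fun k => (hPt.2 k x hx).2) k⟩, hk⟩
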